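/- arXiv:1611.10101 — 2 statements merged into one kernel-verified Lean document; each statement's English description precedes it below -/
import Mathlib

section
/- Let k be an algebraically closed field of characteristic zero containing ε with ord(ε) = 7. Every subgroup of PGL_4(k) isomorphic to Z/7Z is conjugate to one of the seven cyclic subgroups generated by the images of diag[1,1,ε,1], diag[1,1,ε,ε], diag[1,1,ε,ε²], diag[1,1,ε,ε³], diag[1,1,ε,ε⁶], diag[1,ε,ε²,ε³], and diag[1,ε,ε²,ε⁴]. -/
open Matrix

/-- The diagonal matrix with unit entries, as an element of `GL (Fin 4) k`. -/
noncomputable def diagGL {k : Type*} [Field k] (u : Fin 4 → kˣ) :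
    Matrix.GeneralLinearGroup (Fin 4) k where
  val := Matrix.diagonal fun i => (u i : k)
  inv := Matrix.diagonal fun i => ((u i)⁻¹ : kˣ)
  val_inv := by
    rw [Matrix.diagonal_mul_diagonal]
    simp [← Units.val_mul]
  inv_val := by
    rw [Matrix.diagonal_mul_diagonal]
    simp [← Units.val_mul]

/-- A matrix of finite multiplicative order is diagonalizable over an algebraically closed field
in which the order is invertible. -/
theorem exists_mul_eq_mul_diagonal_of_pow_eq_one {k n : Type*} [Field k] [IsAlgClosed k]
    [Fintype n] [DecidableEq n] {m : ℕ} (hm : (m : k) ≠ 0) (M : Matrix n n k) (hM : M ^ m = 1) :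
    ∃ (P : GL n k) (μ : n → k), M * (P : Matrix n n k) = (P : Matrix n n k) * diagonal μ := by
  classical
  let f : Module.End k (n → k) := toLin' M
  have hss : f.IsSemisimple := by
    refine Module.End.isSemisimple_of_squarefree_aeval_eq_zero (p := Polynomial.X ^ m - 1)
      (Polynomial.X_pow_sub_one_separable_iff.mpr hm).squarefree ?_
    have h : f ^ m = 1 := by
      rw [show f = toLin' M from rfl, ← toLin'_pow, hM, toLin'_one]
      rfl
    simp [h]
  obtain ⟨b, μ, hb⟩ : ∃ (b : Module.Basis n k (n → k)) (μ : n → k), ∀ j, f (b j) = μ j • b j := by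
    let dec := DirectSum.isInternal_submodule_of_iSupIndep_of_iSup_eq_top
      f.eigenspaces_iSupIndep hss.iSup_eigenspace_eq_top
    let v := dec.collectedBasis fun μ ↦ Module.finBasis k (f.eigenspace μ)
    have hv i : f (v i) = i.1 • v i :=
      Module.End.mem_eigenspace_iff.mp (dec.collectedBasis_mem _ i)
    let e := v.indexEquiv (Pi.basisFun k n)
    exact ⟨v.reindex e, fun j ↦ (e.symm j).1, fun j ↦ by simpa using hv (e.symm j)⟩
  refine ⟨⟨(Pi.basisFun k n).toMatrix b, b.toMatrix (Pi.basisFun k n),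
    Module.Basis.toMatrix_mul_toMatrix_flip _ _, Module.Basis.toMatrix_mul_toMatrix_flip _ _⟩,
    μ, ?_⟩
  ext i j
  rw [mul_diagonal, mul_comm]
  exact congrFun (hb j) i

section diagGL

variable {k : Type*} [Field k]

theorem diagGL_mul (u v : Fin 4 → kˣ) : diagGL (u * v) = diagGL u * diagGL v := by
  ext1
  simp [diagGL]

theorem diagGL_pow (u : Fin 4 → kˣ) (n : ℕ) : diagGL (u ^ n) = diagGL u ^ n := by
  induction n with
  | zero =>
    ext1
    simp [diagGL]
  | succ n ih => rw [pow_succ, pow_succ, diagGL_mul, ih]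

theorem diagGL_const_mem_center (c : kˣ) :
    diagGL (fun _ ↦ c) ∈ Subgroup.center (GL (Fin 4) k) :=
  Matrix.GeneralLinearGroup.mem_center_iff_val_mem_range_scalar.mpr ⟨c, rfl⟩

/-- Permuting the diagonal entries is a conjugation. -/
theorem exists_diagGL_comp_perm (u : Fin 4 → kˣ) (σ : Equiv.Perm (Fin 4)) :
    ∃ S : GL (Fin 4) k, diagGL (u ∘ σ) = S * diagGL u * S⁻¹ := by
  refine ⟨⟨σ.permMatrix k, (σ⁻¹).permMatrix k, ?_, ?_⟩, ?_⟩
  · rw [← Matrix.permMatrix_mul]; simp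
  · rw [← Matrix.permMatrix_mul]; simp
  · rw [eq_mul_inv_iff_mul_eq]
    ext i j
    simp [diagGL, Equiv.Perm.permMatrix, PEquiv.toMatrix_apply, diagonal_mul, mul_diagonal,
      Equiv.toPEquiv_apply]
    by_cases h : σ i = j <;> simp [h]

end diagGL

theorem injective_vec_four {α : Type*} {i j l m : α} (hji : j ≠ i) (hli : l ≠ i) (hlj : l ≠ j)
    (hmi : m ≠ i) (hmj : m ≠ j) (hml : m ≠ l) : Function.Injective ![i, j, l, m] := by
  simp [Function.Injective, Fin.forall_fin_succ, *, hji.symm, hli.symm, hlj.symm,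
    hmi.symm, hmj.symm, hml.symm]

/-- Affine transformations and permutations bring every nonconstant quadruple in `ZMod 7`
to one of seven normal forms. -/
theorem exists_affine_normal_form (a : Fin 4 → ZMod 7) (ha : ∃ i j, a i ≠ a j) :
    ∃ c ∈ ([![0, 0, 1, 0], ![0, 0, 1, 1], ![0, 0, 1, 2], ![0, 0, 1, 3], ![0, 0, 1, 6],
        ![0, 1, 2, 3], ![0, 1, 2, 4]] : List (Fin 4 → ZMod 7)),
      ∃ s t : ZMod 7, ∃ σ : Equiv.Perm (Fin 4), s ≠ 0 ∧ ∀ i, c i = s * a (σ i) + t := by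
  obtain ⟨i, j, hij⟩ := ha
  obtain ⟨τ, rfl, rfl⟩ : ∃ τ : Equiv.Perm (Fin 4), τ 0 = i ∧ τ 1 = j := by
    have hne : i ≠ j := fun h ↦ hij (h ▸ rfl)
    clear hij
    decide +revert
  have key : ∀ x y : ZMod 7, ∃ c ∈ ([![0, 0, 1, 0], ![0, 0, 1, 1], ![0, 0, 1, 2], ![0, 0, 1, 3],
      ![0, 0, 1, 6], ![0, 1, 2, 3], ![0, 1, 2, 4]] : List (Fin 4 → ZMod 7)),
      ∃ s : ZMod 7, s ≠ 0 ∧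
      ∃ i j, j ≠ i ∧ c 1 = s * (![0, 1, x, y] j - ![0, 1, x, y] i) ∧
      ∃ l, l ≠ i ∧ l ≠ j ∧ c 2 = s * (![0, 1, x, y] l - ![0, 1, x, y] i) ∧
      ∃ m, m ≠ i ∧ m ≠ j ∧ m ≠ l ∧ c 3 = s * (![0, 1, x, y] m - ![0, 1, x, y] i) := by
    decide +kernel
  have : Fact (Nat.Prime 7) := ⟨by norm_num⟩
  have hd : a (τ 1) - a (τ 0) ≠ 0 := sub_ne_zero.mpr hij.symm
  obtain ⟨c, hc, s, hs, i, j, hji, h1, l, hli, hlj, h2, m, hmi, hmj, hml, h3⟩ :=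
    key ((a (τ 2) - a (τ 0)) / (a (τ 1) - a (τ 0))) ((a (τ 3) - a (τ 0)) / (a (τ 1) - a (τ 0)))
  have h0 : c 0 = 0 := by
    clear h1 h2 h3
    fin_cases hc <;> rfl
  have hb r : ![0, 1, (a (τ 2) - a (τ 0)) / (a (τ 1) - a (τ 0)),
      (a (τ 3) - a (τ 0)) / (a (τ 1) - a (τ 0))] r =
      (a (τ r) - a (τ 0)) / (a (τ 1) - a (τ 0)) := by
    fin_cases r <;> simp [div_self hd]
  have hσ : Function.Injective ![i, j, l, m] :=
    injective_vec_four hji hli hlj hmi hmj hml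
  refine ⟨c, hc, s / (a (τ 1) - a (τ 0)), -(s * a (τ i) / (a (τ 1) - a (τ 0))),
    (Equiv.ofBijective _ (Finite.injective_iff_bijective.mp hσ)).trans τ,
    div_ne_zero hs hd, fun r ↦ ?_⟩
  rw [hb, hb] at h1 h2 h3
  fin_cases r <;> simp [h0, h1, h2, h3] <;> ring

theorem pow_val_mul_add {H : Type*} [CommGroup H] {n : ℕ} [NeZero n] {x : H} (hx : x ^ n = 1)
    (s a t : ZMod n) : x ^ (s * a + t).val = (x ^ a.val) ^ s.val * x ^ t.val := by
  rw [← pow_mul, ← pow_add]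
  refine pow_eq_pow_iff_modEq.mpr (Nat.ModEq.of_dvd (orderOf_dvd_of_pow_eq_one hx) ?_)
  rw [← ZMod.natCast_eq_natCast_iff]
  simp [mul_comm]

/-- Every element of order dividing `n` in `PGL₄(k)` lifts to one in `GL₄(k)`. -/
theorem exists_lift_pow_eq_one {k : Type*} [Field k] [IsAlgClosed k] {n : ℕ} (hn : n ≠ 0)
    (g : GL (Fin 4) k ⧸ Subgroup.center (GL (Fin 4) k)) (hg : g ^ n = 1) :
    ∃ A : GL (Fin 4) k, A ^ n = 1 ∧ (A : GL (Fin 4) k ⧸ Subgroup.center (GL (Fin 4) k)) = g := by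
  obtain ⟨A, rfl⟩ := QuotientGroup.mk_surjective g
  rw [← QuotientGroup.mk_pow, QuotientGroup.eq_one_iff,
    Matrix.GeneralLinearGroup.center_eq_range_scalar] at hg
  obtain ⟨c, hc⟩ := hg
  obtain ⟨d, hd⟩ := IsAlgClosed.exists_pow_nat_eq (c : k) (Nat.pos_of_ne_zero hn)
  have hd0 : d ≠ 0 := by
    rintro rfl
    exact c.ne_zero (by rw [← hd, zero_pow hn])
  have hdc : Units.mk0 d hd0 ^ n = c := Units.ext (by simpa using hd)
  have hz : Matrix.GeneralLinearGroup.scalar (Fin 4) (Units.mk0 d hd0) ∈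
      Subgroup.center (GL (Fin 4) k) := by
    rw [Matrix.GeneralLinearGroup.center_eq_range_scalar]
    exact ⟨_, rfl⟩
  refine ⟨A * (Matrix.GeneralLinearGroup.scalar (Fin 4) (Units.mk0 d hd0))⁻¹, ?_, ?_⟩
  · have hcomm : Commute A (Matrix.GeneralLinearGroup.scalar (Fin 4) (Units.mk0 d hd0))⁻¹ :=
      Subgroup.mem_center_iff.mp (inv_mem hz) A
    rw [hcomm.mul_pow, inv_pow, ← map_pow, hdc, hc, mul_inv_cancel]
  · exact QuotientGroup.mk_mul_of_mem A (inv_mem hz)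

/-- A matrix of order dividing `n` is conjugate to a diagonal matrix of powers of a primitive
`n`th root of unity. -/
theorem exists_conj_eq_diagGL {k : Type*} [Field k] [IsAlgClosed k] {n : ℕ} [NeZero n]
    (hn : (n : k) ≠ 0) {ε : kˣ} (hε : orderOf ε = n) (A : GL (Fin 4) k) (hA : A ^ n = 1) :
    ∃ (P : GL (Fin 4) k) (a : Fin 4 → ZMod n),
      P * A * P⁻¹ = diagGL fun i ↦ ε ^ (a i).val := by
  obtain ⟨P, μ, hP⟩ := exists_mul_eq_mul_diagonal_of_pow_eq_one hn (A : Matrix (Fin 4) (Fin 4) k)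
    (by rw [← Units.val_pow_eq_pow_val, hA, Units.val_one])
  have hconj : ((P⁻¹ * A * P : GL (Fin 4) k) : Matrix (Fin 4) (Fin 4) k) = diagonal μ := by
    rw [Units.val_mul, Units.val_mul, mul_assoc, hP, Units.inv_mul_cancel_left]
  have hpow : (P⁻¹ * A * P) ^ n = 1 := by
    have := conj_pow (i := n) (a := P⁻¹) (b := A)
    rw [inv_inv] at this
    rw [this, hA]
    simp
  have hμ i : μ i ^ n = 1 := by
    have h := congrArg Units.val hpow
    rw [Units.val_pow_eq_pow_val, hconj, diagonal_pow, Units.val_one, ← diagonal_one] at h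
    exact congrFun (diagonal_injective h) i
  have hprim : IsPrimitiveRoot (ε : k) n :=
    IsPrimitiveRoot.coe_units_iff.mpr (hε ▸ IsPrimitiveRoot.orderOf ε)
  choose m hm hmμ using fun i ↦ hprim.eq_pow_of_pow_eq_one (hμ i)
  refine ⟨P⁻¹, fun i ↦ m i, Units.ext ?_⟩
  rw [inv_inv, hconj]
  simp [diagGL, ZMod.val_natCast_of_lt (hm _), hmμ]

/-- STATEMENT 5: every subgroup of `PGL₄(k)` isomorphic to `ℤ/7ℤ` is conjugate to one of
the seven cyclic subgroups generated by the images of the diagonal matrices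
`diag[1,1,ε,1]`, `diag[1,1,ε,ε]`, `diag[1,1,ε,ε²]`, `diag[1,1,ε,ε³]`, `diag[1,1,ε,ε⁶]`, `diag[1,ε,ε²,ε³]`, `diag[1,ε,ε²,ε⁴]`,
where `ε` is a primitive 7th root of unity. -/
theorem stmt_6 {k : Type*} [Field k] [IsAlgClosed k] [CharZero k] (ε : kˣ)
    (hε : orderOf ε = 7)
    (G : Subgroup (Matrix.GeneralLinearGroup (Fin 4) k ⧸
      Subgroup.center (Matrix.GeneralLinearGroup (Fin 4) k)))
    (hG : Nonempty (G ≃* Multiplicative (ZMod 7))) :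
    ∃ D ∈ ({![1, 1, ε, 1], ![1, 1, ε, ε], ![1, 1, ε, ε ^ 2], ![1, 1, ε, ε ^ 3], ![1, 1, ε, ε ^ 6],
        ![1, ε, ε ^ 2, ε ^ 3], ![1, ε, ε ^ 2, ε ^ 4]} : Set (Fin 4 → kˣ)),
      ∃ T, Subgroup.map (MulAut.conj T).toMonoidHom G =
        Subgroup.zpowers (QuotientGroup.mk (diagGL D)) := by
  have : Fact (Nat.Prime 7) := ⟨by norm_num⟩
  have h7 : ε ^ 7 = 1 := hε ▸ pow_orderOf_eq_one ε
  obtain ⟨φ⟩ := hG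
  have hcard : Nat.card G = 7 := by
    rw [Nat.card_congr φ.toEquiv]
    simp
  have : IsCyclic G := isCyclic_of_prime_card hcard
  obtain ⟨g, hgen⟩ := G.isCyclic_iff_exists_zpowers_eq_top.mp this
  have hg : orderOf g = 7 := by rw [← Nat.card_zpowers, hgen, hcard]
  obtain ⟨A, hA, rfl⟩ := exists_lift_pow_eq_one (n := 7) (by norm_num) g
    (hg ▸ pow_orderOf_eq_one g)
  obtain ⟨P, a, hP⟩ := exists_conj_eq_diagGL (n := 7) (by norm_num) hε A hA
  have ha : ∃ i j, a i ≠ a j := by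
    by_contra! hconst
    have hmem : P * A * P⁻¹ ∈ Subgroup.center (GL (Fin 4) k) := by
      rw [hP, funext fun i ↦ congrArg (fun x : ZMod 7 ↦ ε ^ x.val) (hconst i 0)]
      exact diagGL_const_mem_center _
    have hmem' : A ∈ Subgroup.center (GL (Fin 4) k) := by
      simpa [mul_assoc] using (inferInstance : (Subgroup.center (GL (Fin 4) k)).Normal).conj_mem
        _ hmem P⁻¹
    rw [(QuotientGroup.eq_one_iff A).mpr hmem', orderOf_one] at hg
    norm_num at hg
  obtain ⟨c, hc, s, t, σ, hs, hcs⟩ := exists_affine_normal_form a ha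
  obtain ⟨S, hS⟩ := exists_diagGL_comp_perm (fun i ↦ ε ^ (a i).val) σ
  refine ⟨fun i ↦ ε ^ (c i).val, ?_, QuotientGroup.mk (S * P), ?_⟩
  · have hval : (2 : ZMod 7).val = 2 ∧ (3 : ZMod 7).val = 3 ∧ (4 : ZMod 7).val = 4 ∧
        (6 : ZMod 7).val = 6 ∧ (1 : ZMod 7).val = 1 := ⟨rfl, rfl, rfl, rfl, rfl⟩
    obtain ⟨h2, h3, h4, h6, h1⟩ := hval
    have hcomp w x y z : (fun i ↦ ε ^ ((![w, x, y, z] : Fin 4 → ZMod 7) i).val) =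
        ![ε ^ w.val, ε ^ x.val, ε ^ y.val, ε ^ z.val] := by
      funext i
      fin_cases i <;> rfl
    fin_cases hc <;> simp [hcomp, h1, h2, h3, h4, h6]
  · have hD : diagGL (fun i ↦ ε ^ (c i).val) =
        (S * P * A * (S * P)⁻¹) ^ s.val * diagGL fun _ ↦ ε ^ t.val := by
      have : S * P * A * (S * P)⁻¹ = S * (P * A * P⁻¹) * S⁻¹ := by group
      rw [this, hP, ← hS, ← diagGL_pow, ← diagGL_mul]
      congr 1
      funext i
      rw [hcs, pow_val_mul_add h7]
      rfl
    have hmk : (QuotientGroup.mk (diagGL fun i ↦ ε ^ (c i).val) :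
        GL (Fin 4) k ⧸ Subgroup.center (GL (Fin 4) k)) =
        MulAut.conj (QuotientGroup.mk (S * P)) (QuotientGroup.mk A) ^ s.val := by
      rw [hD, QuotientGroup.mk_mul_of_mem _ (diagGL_const_mem_center _)]
      rfl
    rw [← hgen, MonoidHom.map_zpowers, hmk]
    refine le_antisymm (Subgroup.zpowers_le.mpr ?_)
      (Subgroup.zpowers_le.mpr (Subgroup.npow_mem_zpowers _ _))
    rw [MulEquiv.coe_toMonoidHom, mem_zpowers_pow_iff, MulEquiv.orderOf_eq, hg]
    exact ZMod.val_coe_unit_coprime (Units.mk0 s hs)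
end

section
/- Let p ≥ 11 be a prime and k an algebraically closed field of characteristic zero. Then every quartic form f ∈ k[x,y,z,t] that is invariant under some subgroup of PGL_4(k) isomorphic to Z/pZ is singular. Equivalently, if f is a nonsingular quartic form, then p does not divide |Paut(f)| for any prime p ≥ 11. -/
open MvPolynomial

/-- A quartic form in `k[x,y,z,t]` is singular if its four partial derivatives have a common
zero in `k⁴ \ {0}`. -/
def MvPolynomial.IsSingularForm {k : Type*} [CommRing k] (f : MvPolynomial (Fin 4) k) : Prop :=
  ∃ p : Fin 4 → k, p ≠ 0 ∧ ∀ i : Fin 4, eval p (pderiv i f) = 0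

/-- The linear substitution action of a matrix on polynomials:
`substM A f = f ∘ A`, i.e. `x_i ↦ ∑ j, A i j * x_j`. -/
noncomputable def substM {k : Type*} [CommSemiring k] (A : Matrix (Fin 4) (Fin 4) k)
    (f : MvPolynomial (Fin 4) k) : MvPolynomial (Fin 4) k :=
  aeval (fun i => ∑ j : Fin 4, MvPolynomial.C (A i j) * X j) f

/-- `(A) ∈ PGL₄(k)` is a projective automorphism of the form `f` if the substitution by
`A⁻¹` sends `f` to a nonzero scalar multiple of itself. -/
def IsProjAut {k : Type*} [Field k] (f : MvPolynomial (Fin 4) k)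
    (A : Matrix.GeneralLinearGroup (Fin 4) k) : Prop :=
  ∃ c : kˣ, substM (↑(A⁻¹) : Matrix (Fin 4) (Fin 4) k) f = (c : k) • f

/-- The number of projective automorphisms of `f`, i.e. `|Paut(f)|`, counted as a subset of
`PGL₄(k) = GL₄(k)/center`. -/
noncomputable def pautCard {k : Type*} [Field k] (f : MvPolynomial (Fin 4) k) : ℕ :=
  Nat.card {x : Matrix.GeneralLinearGroup (Fin 4) k ⧸
      Subgroup.center (Matrix.GeneralLinearGroup (Fin 4) k) //
    ∃ A : Matrix.GeneralLinearGroup (Fin 4) k, QuotientGroup.mk A = x ∧ IsProjAut f A}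

open Matrix

section Gradient

variable {k : Type*}

/-- The gradient of `f` at the point `x`. -/
noncomputable def MvPolynomial.gradAt [CommRing k] (f : MvPolynomial (Fin 4) k) (x : Fin 4 → k) :
    Fin 4 → k :=
  fun i => eval x (pderiv i f)

theorem eval_substM [CommRing k] (A : Matrix (Fin 4) (Fin 4) k) (f : MvPolynomial (Fin 4) k)
    (x : Fin 4 → k) : eval x (substM A f) = eval (A *ᵥ x) f := by
  have h : (aeval x).comp (aeval (fun i => ∑ j : Fin 4, MvPolynomial.C (A i j) * X j)) =
      (aeval (A *ᵥ x) : MvPolynomial (Fin 4) k →ₐ[k] k) := by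
    ext i
    simp [mulVec, dotProduct]
  exact DFunLike.congr_fun h f

theorem substM_one [CommRing k] (f : MvPolynomial (Fin 4) k) : substM 1 f = f := by
  simp [substM, Matrix.one_apply]

theorem substM_mul [CommRing k] (A B : Matrix (Fin 4) (Fin 4) k) (f : MvPolynomial (Fin 4) k) :
    substM (A * B) f = substM B (substM A f) := by
  have h : (aeval (fun i => ∑ j : Fin 4, MvPolynomial.C ((A * B) i j) * X j) :
      MvPolynomial (Fin 4) k →ₐ[k] MvPolynomial (Fin 4) k) =
      (aeval (fun i => ∑ j : Fin 4, MvPolynomial.C (B i j) * X j)).comp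
        (aeval (fun i => ∑ j : Fin 4, MvPolynomial.C (A i j) * X j)) := by
    ext1 i
    simp only [aeval_X, AlgHom.comp_apply, map_sum, map_mul, algHom_C, algebraMap_eq,
      Matrix.mul_apply, Finset.sum_mul, Finset.mul_sum, mul_assoc]
    exact Finset.sum_comm
  exact DFunLike.congr_fun h f

theorem substM_pow [CommRing k] {B : Matrix (Fin 4) (Fin 4) k} {f : MvPolynomial (Fin 4) k}
    (h : substM B f = f) (m : ℕ) : substM (B ^ m) f = f := by
  induction m with
  | zero => simpa using substM_one f
  | succ m ih => rw [pow_succ, substM_mul, ih, h]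

theorem substM_smul_matrix [CommRing k] {f : MvPolynomial (Fin 4) k} {d : ℕ}
    (hf : f.IsHomogeneous d) (c : k) (A : Matrix (Fin 4) (Fin 4) k) :
    substM (c • A) f = c ^ d • substM A f := by
  have h (i : Fin 4) : ∑ j : Fin 4, MvPolynomial.C ((c • A) i j) * X j =
      MvPolynomial.C c * ∑ j : Fin 4, MvPolynomial.C (A i j) * X j := by
    simp [Finset.mul_sum, mul_assoc]
  simp only [substM, aeval_def, eval₂_eq', h, mul_pow, Finset.prod_mul_distrib,
    Finset.prod_pow_eq_pow_sum, smul_eq_C_mul]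
  rw [Finset.mul_sum]
  refine Finset.sum_congr rfl fun e he => ?_
  have hd : ∑ i, e i = d := by
    simpa [Finsupp.weight_apply, Finsupp.sum_fintype] using hf (mem_support_iff.mp he)
  rw [hd, map_pow]
  ring

theorem pderiv_substM [CommRing k] (A : Matrix (Fin 4) (Fin 4) k) (f : MvPolynomial (Fin 4) k)
    (j : Fin 4) :
    pderiv j (substM A f) = ∑ i, MvPolynomial.C (A i j) * substM A (pderiv i f) := by
  unfold substM
  induction f using MvPolynomial.induction_on with
  | C a => simp
  | add p q hp hq => simp only [map_add, hp, hq, mul_add, Finset.sum_add_distrib]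
  | mul_X p n hp =>
    have h : pderiv j (∑ l : Fin 4, MvPolynomial.C (A n l) * X l) = MvPolynomial.C (A n j) := by
      simp [pderiv_X, Pi.single_apply]
    simp only [map_mul, aeval_X, Derivation.leibniz, hp, h, smul_eq_mul, map_add, mul_add,
      Finset.sum_add_distrib, pderiv_X]
    congr 1
    · rw [Finset.sum_eq_single n (fun i _ hi => by simp [Pi.single_eq_of_ne' hi]) (by simp),
        Pi.single_eq_same, map_one, mul_one, mul_comm]
    · rw [Finset.mul_sum]
      exact Finset.sum_congr rfl fun i _ => by ring

theorem gradAt_substM [CommRing k] (A : Matrix (Fin 4) (Fin 4) k) (f : MvPolynomial (Fin 4) k)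
    (x : Fin 4 → k) : (substM A f).gradAt x = f.gradAt (A *ᵥ x) ᵥ* A := by
  ext j
  simp [gradAt, pderiv_substM, eval_substM, vecMul, dotProduct, mul_comm]

theorem MvPolynomial.IsHomogeneous.eval_smul {σ : Type*} [Fintype σ] [CommRing k]
    {f : MvPolynomial σ k} {d : ℕ} (hf : f.IsHomogeneous d) (c : k) (x : σ → k) :
    eval (c • x) f = c ^ d * eval x f := by
  simp only [eval_eq', Finset.mul_sum, Pi.smul_apply, smul_eq_mul, mul_pow,
    Finset.prod_mul_distrib, Finset.prod_pow_eq_pow_sum]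
  refine Finset.sum_congr rfl fun e he => ?_
  have hd : ∑ i, e i = d := by
    simpa [Finsupp.weight_apply, Finsupp.sum_fintype] using hf (mem_support_iff.mp he)
  rw [hd]
  ring

theorem gradAt_ne_zero [CommRing k] {f : MvPolynomial (Fin 4) k} (hf : ¬ f.IsSingularForm)
    {x : Fin 4 → k} (hx : x ≠ 0) : f.gradAt x ≠ 0 :=
  fun h => hf ⟨x, hx, fun i => congrFun h i⟩

end Gradient

section LeadingCoefficient

variable {k : Type*} [CommRing k]

theorem Polynomial.coeff_prod_sum_of_natDegree_le {ι : Type*} (s : Finset ι)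
    (g : ι → Polynomial k) (e : ι → ℕ) (h : ∀ i ∈ s, (g i).natDegree ≤ e i) :
    (∏ i ∈ s, g i).coeff (∑ i ∈ s, e i) = ∏ i ∈ s, (g i).coeff (e i) := by
  classical
  induction s using Finset.induction_on with
  | empty => simp
  | insert a s ha ih =>
    have hs : ∀ i ∈ s, (g i).natDegree ≤ e i := fun i hi => h i (Finset.mem_insert_of_mem hi)
    rw [Finset.prod_insert ha, Finset.sum_insert ha, Finset.prod_insert ha,
      coeff_mul_add_eq_of_natDegree_le (h a (Finset.mem_insert_self a s))
        ((natDegree_prod_le _ _).trans (Finset.sum_le_sum hs)), ih hs]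

theorem MvPolynomial.IsHomogeneous.coeff_aeval {σ : Type*} [Fintype σ] {f : MvPolynomial σ k}
    {d : ℕ} (hf : f.IsHomogeneous d) {c : σ → Polynomial k} {D : ℕ}
    (hc : ∀ i, (c i).natDegree ≤ D) :
    (MvPolynomial.aeval c f).coeff (d * D) = eval (fun i => (c i).coeff D) f := by
  rw [MvPolynomial.aeval_def, eval₂_eq', eval_eq', Polynomial.finsetSum_coeff]
  refine Finset.sum_congr rfl fun e he => ?_
  have hd : ∑ i, e i = d := by
    simpa [Finsupp.weight_apply, Finsupp.sum_fintype] using hf (mem_support_iff.mp he)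
  rw [Polynomial.algebraMap_eq, Polynomial.coeff_C_mul, ← hd, Finset.sum_mul,
    Polynomial.coeff_prod_sum_of_natDegree_le]
  · simp [Polynomial.coeff_pow_of_natDegree_le (hc _)]
  · exact fun i _ => Polynomial.natDegree_pow_le_of_le _ (hc i)

end LeadingCoefficient

section FiniteExponent

variable {k : Type*} [Field k] {n : Type*} [Fintype n] [DecidableEq n]

theorem Matrix.exists_mulVec_eq_smul_of_mem_roots_charpoly {A : Matrix n n k} {a : k}
    (h : a ∈ A.charpoly.roots) : ∃ v ≠ 0, A *ᵥ v = a • v := by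
  have h0 := Polynomial.isRoot_of_mem_roots h
  rw [Polynomial.IsRoot, eval_charpoly, ← exists_mulVec_eq_zero_iff] at h0
  obtain ⟨v, hv, h0⟩ := h0
  rw [sub_mulVec, sub_eq_zero] at h0
  exact ⟨v, hv, by simpa [← smul_one_eq_diagonal, smul_mulVec] using h0.symm⟩

theorem Matrix.pow_mulVec_eq_smul {A : Matrix n n k} {a : k} {v : n → k} (h : A *ᵥ v = a • v)
    (m : ℕ) : (A ^ m) *ᵥ v = a ^ m • v := by
  induction m with
  | zero => simp
  | succ m ih => rw [pow_succ, ← mulVec_mulVec, h, mulVec_smul, ih, smul_smul, pow_succ']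

theorem Matrix.finite_trace_of_pow_eq_one [IsAlgClosed k] {M : ℕ} (hM : M ≠ 0) :
    {t : k | ∃ A : Matrix n n k, A ^ M = 1 ∧ A.trace = t}.Finite := by
  classical
  refine ((Set.finite_Iic (Fintype.card n • (Polynomial.nthRoots M (1 : k)).dedup)).image
    Multiset.sum).subset ?_
  rintro _ ⟨A, hA, rfl⟩
  refine ⟨A.charpoly.roots, Multiset.le_iff_count.mpr fun a => ?_,
    A.trace_eq_sum_roots_charpoly.symm⟩
  by_cases ha : a ∈ A.charpoly.roots
  · have h1 : a ∈ (Polynomial.nthRoots M (1 : k)).dedup := by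
      obtain ⟨v, hv, hav⟩ := exists_mulVec_eq_smul_of_mem_roots_charpoly ha
      have := pow_mulVec_eq_smul hav M
      rw [hA, one_mulVec] at this
      rw [Multiset.mem_dedup, Polynomial.mem_nthRoots (Nat.pos_of_ne_zero hM)]
      exact smul_left_injective k hv (by simpa using this.symm)
    rw [Multiset.count_nsmul, Multiset.count_eq_one_of_mem (Multiset.nodup_dedup _) h1, mul_one,
      ← A.charpoly_natDegree_eq_dim]
    exact (Multiset.count_le_card _ _).trans (Polynomial.card_roots' _)
  · simp [Multiset.count_eq_zero_of_notMem ha]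

variable [CharZero k]

theorem Matrix.eq_zero_of_isIdempotentElem_of_trace_eq_zero {e : Matrix n n k}
    (he : IsIdempotentElem e) (h : e.trace = 0) : e = 0 := by
  have h1 : IsIdempotentElem (toLin' e) := by
    rw [IsIdempotentElem, Module.End.mul_eq_comp, ← toLin'_mul, he.eq]
  have h2 : LinearMap.trace k _ (toLin' e) = 0 := by rwa [trace_toLin'_eq]
  simpa using LinearMap.IsIdempotentElem.eq_zero_of_trace_eq_zero h1 h2

theorem Matrix.eq_one_of_trace_pow_succ_eq {u : Matrix n n k} {M : ℕ} (hM : M ≠ 0)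
    (hu : u ^ M = 1) (h : ∀ m, (u ^ (m + 1)).trace = (u ^ m).trace) : u = 1 := by
  have htr : ∀ m, (u ^ m).trace = (1 : Matrix n n k).trace := fun m => by
    induction m with
    | zero => simp
    | succ m ih => rw [h, ih]
  have hM' : (M : k) ≠ 0 := Nat.cast_ne_zero.mpr hM
  let s := ∑ i ∈ Finset.range M, u ^ i
  have hus : u * s = s := by
    have := mul_geom_sum u M
    rw [hu, sub_self, sub_mul, one_mul, sub_eq_zero] at this
    exact this
  have hpow : ∀ m, u ^ m * s = s := fun m => by
    induction m with
    | zero => simp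
    | succ m ih => rw [pow_succ, mul_assoc, hus, ih]
  have hss : s * s = (M : k) • s := by
    conv_lhs => enter [1]; unfold s
    rw [Finset.sum_mul, Finset.sum_congr rfl fun m _ => hpow m]
    simp [← Nat.cast_smul_eq_nsmul k]
  have he : IsIdempotentElem ((M : k)⁻¹ • s) := by
    rw [IsIdempotentElem, smul_mul_smul_comm, hss, smul_smul]
    congr 1
    field_simp
  have htrs : ((M : k)⁻¹ • s).trace = (1 : Matrix n n k).trace := by
    rw [trace_smul, trace_sum, Finset.sum_congr rfl fun m _ => htr m]
    simp [hM']
  have h1 := eq_zero_of_isIdempotentElem_of_trace_eq_zero he.one_sub (by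
    rw [trace_sub, htrs, sub_self])
  have h2 : (M : k)⁻¹ • s = 1 := (sub_eq_zero.mp h1).symm
  calc u = u * ((M : k)⁻¹ • s) := by rw [h2, mul_one]
    _ = 1 := by rw [mul_smul_comm, hus, h2]

/-- **Burnside's theorem**: a linear group of finite exponent over a field of characteristic
zero is finite. -/
theorem Matrix.GeneralLinearGroup.finite_of_pow_eq_one [IsAlgClosed k] {M : ℕ} (hM : M ≠ 0)
    (S : Subgroup (GL n k)) (hS : ∀ g ∈ S, g ^ M = 1) : Finite S := by
  obtain ⟨T, hTS, hT⟩ := (Submodule.fg_span_iff_fg_span_finset_subset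
    (Units.val '' (S : Set (GL n k)))).mp (IsNoetherian.noetherian (Submodule.span k _))
  have hval : ∀ g ∈ S, (g : Matrix n n k) ^ M = 1 := fun g hg => by
    rw [← Units.val_pow_eq_pow_val, hS g hg, Units.val_one]
  have : Finite {t : k | ∃ A : Matrix n n k, A ^ M = 1 ∧ A.trace = t} :=
    finite_trace_of_pow_eq_one hM
  let φ : S → T → {t : k | ∃ A : Matrix n n k, A ^ M = 1 ∧ A.trace = t} := fun g t =>
    ⟨((g : GL n k) * t : Matrix n n k).trace, (g : GL n k) * t, by
      obtain ⟨h, hh, e⟩ := hTS t.2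
      rw [← e, ← Units.val_mul]
      exact hval _ (S.mul_mem g.2 hh), rfl⟩
  refine Finite.of_injective φ fun g h hgh => ?_
  have htr : ∀ a ∈ S, ((g : GL n k) * a : Matrix n n k).trace =
      ((h : GL n k) * a : Matrix n n k).trace := fun a ha => by
    have hmem : (a : Matrix n n k) ∈ Submodule.span k (T : Set (Matrix n n k)) :=
      hT ▸ Submodule.subset_span ⟨a, ha, rfl⟩
    generalize (a : Matrix n n k) = b at hmem ⊢
    induction hmem using Submodule.span_induction with
    | mem t ht => exact congrArg Subtype.val (congrFun hgh ⟨t, ht⟩)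
    | zero => simp
    | add x y _ _ hx hy => simp only [mul_add, trace_add, hx, hy]
    | smul c x _ hx => simp only [mul_smul_comm, trace_smul, hx]
  have hu : (g : GL n k) * (h : GL n k)⁻¹ ∈ S := S.mul_mem g.2 (S.inv_mem h.2)
  have := eq_one_of_trace_pow_succ_eq hM (hval _ hu) fun m => by
    have := htr _ (S.mul_mem (S.inv_mem h.2) (S.pow_mem hu m))
    simpa only [← Units.val_mul, ← Units.val_pow_eq_pow_val, ← mul_assoc, mul_inv_cancel, one_mul,
      pow_succ'] using this
  exact Subtype.ext (mul_inv_eq_one.mp (Units.ext this))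

end FiniteExponent

section UnipotentOrbit

variable {k : Type*} [Field k] {n : Type*} [Fintype n] [DecidableEq n]

/-- For `N ^ (D + 1) = 0`, the polynomial interpolating the `i`-th coordinate of
`m ↦ (1 + N) ^ m *ᵥ x`. -/
noncomputable def Matrix.orbitPoly (N : Matrix n n k) (D : ℕ) (x : n → k) (i : n) :
    Polynomial k :=
  ∑ j ∈ Finset.range (D + 1),
    Polynomial.C (((N ^ j) *ᵥ x) i / (j.factorial : k)) * descPochhammer k j

theorem Matrix.eval_orbitPoly [CharZero k] {N : Matrix n n k} {D : ℕ} (hN : N ^ (D + 1) = 0)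
    (x : n → k) (i : n) (m : ℕ) : (orbitPoly N D x i).eval (m : k) = (((1 + N) ^ m) *ᵥ x) i := by
  have h : (1 + N) ^ m = ∑ j ∈ Finset.range (D + 1), (m.choose j : k) • N ^ j := by
    rw [add_comm, (Commute.one_right N).add_pow]
    trans ∑ j ∈ Finset.range (max (m + 1) (D + 1)), (m.choose j : k) • N ^ j
    · refine (Finset.sum_congr rfl fun j _ => ?_).trans (Finset.sum_subset
        (Finset.range_mono (le_max_left _ _)) fun j _ hj => ?_)
      · rw [one_pow, mul_one, ← nsmul_eq_mul', Nat.cast_smul_eq_nsmul]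
      · rw [Nat.choose_eq_zero_of_lt (by simpa using hj), Nat.cast_zero, zero_smul]
    · refine (Finset.sum_subset (Finset.range_mono (le_max_right _ _)) fun j _ hj => ?_).symm
      rw [pow_eq_zero_of_le (by simpa using hj) hN, smul_zero]
  rw [h, sum_mulVec, Finset.sum_apply, orbitPoly, Polynomial.eval_finsetSum]
  refine Finset.sum_congr rfl fun j _ => ?_
  rw [Polynomial.eval_mul, Polynomial.eval_C, smul_mulVec, Pi.smul_apply, smul_eq_mul,
    Nat.cast_choose_eq_descPochhammer_div]
  ring

theorem Matrix.natDegree_orbitPoly_le (N : Matrix n n k) (D : ℕ) (x : n → k) (i : n) :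
    (orbitPoly N D x i).natDegree ≤ D := by
  refine Polynomial.natDegree_sum_le_of_forall_le _ _ fun j hj => ?_
  refine (Polynomial.natDegree_C_mul_le _ _).trans ?_
  rw [descPochhammer_natDegree]
  exact Nat.lt_succ_iff.mp (Finset.mem_range.mp hj)

theorem Matrix.coeff_orbitPoly (N : Matrix n n k) (D : ℕ) (x : n → k) (i : n) :
    (orbitPoly N D x i).coeff D = ((N ^ D) *ᵥ x) i / (D.factorial : k) := by
  have hlead : (descPochhammer k D).coeff D = 1 := by
    simpa [Polynomial.Monic, Polynomial.leadingCoeff, descPochhammer_natDegree] using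
      monic_descPochhammer k D
  rw [orbitPoly, Polynomial.finsetSum_coeff, Finset.sum_range_succ, Finset.sum_eq_zero,
    Polynomial.coeff_C_mul, hlead, mul_one, zero_add]
  intro j hj
  rw [Polynomial.coeff_C_mul, Polynomial.coeff_eq_zero_of_natDegree_lt, mul_zero]
  rw [descPochhammer_natDegree]
  exact Finset.mem_range.mp hj

end UnipotentOrbit

section Stabilizer

variable {k : Type*} [Field k] {f : MvPolynomial (Fin 4) k}

theorem gradAt_eq_vecMul_pow {B : Matrix (Fin 4) (Fin 4) k} (hB : substM B f = f)
    (x : Fin 4 → k) (m : ℕ) : f.gradAt x = f.gradAt ((B ^ m) *ᵥ x) ᵥ* B ^ m := by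
  rw [← gradAt_substM, substM_pow hB]

theorem zpow_mem_roots_charpoly (hf : f.IsHomogeneous 4) (hns : ¬ f.IsSingularForm)
    {B : Matrix (Fin 4) (Fin 4) k} (hB : substM B f = f) {a : k} (ha : a ∈ B.charpoly.roots) :
    a ≠ 0 ∧ a ^ (-3 : ℤ) ∈ B.charpoly.roots := by
  obtain ⟨v, hv, hav⟩ := exists_mulVec_eq_smul_of_mem_roots_charpoly ha
  have hg : f.gradAt v = a ^ 3 • (f.gradAt v ᵥ* B) := by
    have h : f.gradAt (a • v) = a ^ 3 • f.gradAt v :=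
      funext fun i => (hf.pderiv (i := i)).eval_smul a v
    rw [← smul_vecMul, ← h, ← hav, ← gradAt_substM, hB]
  have ha0 : a ≠ 0 := by
    rintro rfl
    exact gradAt_ne_zero hns hv (by simpa using hg)
  have hgB : f.gradAt v ᵥ* B = a ^ (-3 : ℤ) • f.gradAt v := by
    conv_rhs => rw [hg]
    rw [smul_smul, _root_.zpow_neg, zpow_ofNat, inv_mul_cancel₀ (pow_ne_zero 3 ha0), one_smul]
  rw [Polynomial.mem_roots B.charpoly_monic.ne_zero, Polynomial.IsRoot, eval_charpoly,
    ← exists_vecMul_eq_zero_iff]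
  refine ⟨ha0, _, gradAt_ne_zero hns hv, ?_⟩
  rw [vecMul_sub, sub_eq_zero, scalar_apply, ← smul_one_eq_diagonal, vecMul_smul, vecMul_one, hgB]

theorem pow_eq_one_of_mem_roots_charpoly (hf : f.IsHomogeneous 4) (hns : ¬ f.IsSingularForm)
    {B : Matrix (Fin 4) (Fin 4) k} (hB : substM B f = f) {a : k} (ha : a ∈ B.charpoly.roots) :
    a ^ 45360 = 1 := by
  have ha0 : a ≠ 0 := (zpow_mem_roots_charpoly hf hns hB ha).1
  classical
  have hmem (i : ℕ) : a ^ ((-3 : ℤ) ^ i) ∈ B.charpoly.roots.toFinset := by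
    rw [Multiset.mem_toFinset]
    induction i with
    | zero => simpa using ha
    | succ i ih =>
      rw [pow_succ, _root_.zpow_mul]
      exact (zpow_mem_roots_charpoly hf hns hB ih).2
  have hcard : B.charpoly.roots.toFinset.card < (Finset.univ : Finset (Fin 5)).card := by
    refine (Multiset.toFinset_card_le _).trans_lt ((Polynomial.card_roots' _).trans_lt ?_)
    simp [charpoly_natDegree_eq_dim]
  obtain ⟨i, -, j, -, hij, h⟩ := Finset.exists_ne_map_eq_of_card_lt_of_maps_to hcard
    (f := fun i : Fin 5 => a ^ ((-3 : ℤ) ^ (i : ℕ))) fun i _ => hmem i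
  have h1 : a ^ ((-3 : ℤ) ^ (i : ℕ) - (-3) ^ (j : ℕ)) = 1 := by
    rw [zpow_sub₀ ha0]
    exact (div_eq_one_iff_eq (zpow_ne_zero _ ha0)).mpr h
  have hdvd : ∀ i j : Fin 5, i ≠ j → (-3 : ℤ) ^ (i : ℕ) - (-3) ^ (j : ℕ) ∣ 45360 := by decide
  obtain ⟨t, ht⟩ := hdvd i j hij
  have h2 : a ^ (45360 : ℤ) = 1 := by rw [ht, _root_.zpow_mul, h1, _root_.one_zpow]
  exact_mod_cast h2

variable [CharZero k]

/-- A unipotent matrix fixing a nonsingular quartic form is trivial: compare the growth in `m` of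
both sides of `∇f(B ^ m x) = ∇f(x) B⁻ᵐ`. -/
theorem eq_one_of_isNilpotent_sub_one (hf : f.IsHomogeneous 4) (hns : ¬ f.IsSingularForm)
    {B : Matrix (Fin 4) (Fin 4) k} (hB : substM B f = f) (hN : IsNilpotent (B - 1)) : B = 1 := by
  by_contra hB1
  obtain ⟨N, rfl⟩ : ∃ N, B = 1 + N := ⟨B - 1, by simp⟩
  rw [add_sub_cancel_left] at hN
  have hN0 : N ≠ 0 := by simpa using hB1
  obtain ⟨D, hD⟩ : ∃ D, nilpotencyClass N = D + 1 :=
    Nat.exists_eq_succ_of_ne_zero (pos_nilpotencyClass_iff.mpr hN).ne'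
  obtain ⟨hND, hND'⟩ := (nilpotencyClass_eq_succ_iff).mp hD
  have hD0 : 0 < D := by
    rcases Nat.eq_zero_or_pos D with rfl | h
    · simp [hN0] at hND
    · exact h
  obtain ⟨x, hx⟩ : ∃ x, (N ^ D) *ᵥ x ≠ 0 := by
    by_contra! h
    exact hND' (Matrix.ext_of_mulVec_single fun i => by rw [h, zero_mulVec])
  obtain ⟨u, hu⟩ := hN.isUnit_one_add
  let P : Matrix (Fin 4) (Fin 4) k := (↑u⁻¹ : Matrix (Fin 4) (Fin 4) k)
  have hP : (1 + N) * P = 1 := by rw [← hu]; exact u.mul_inv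
  have hP' : P * (1 + N) = 1 := by rw [← hu]; exact u.inv_mul
  have hcomm : Commute P N := by
    have h1 : P * N = 1 - P := by rw [eq_sub_iff_add_eq, add_comm, ← hP', mul_add, mul_one]
    have h2 : N * P = 1 - P := by rw [eq_sub_iff_add_eq, add_comm, ← hP, add_mul, one_mul]
    rw [Commute, SemiconjBy, h1, h2]
  have hPN : P = 1 + -(P * N) := by
    rw [← sub_eq_add_neg, eq_sub_iff_add_eq, ← hP', mul_add, mul_one]
  let N' : Matrix (Fin 4) (Fin 4) k := (-(P * N))ᵀ
  have hN' : N' ^ (D + 1) = 0 := by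
    rw [← transpose_pow, neg_pow, hcomm.mul_pow, hND, mul_zero, mul_zero, transpose_zero]
  have hPt : Pᵀ = 1 + N' := by
    conv_lhs => rw [hPN, transpose_add, transpose_one]
  have hgrad (m : ℕ) : f.gradAt (((1 + N) ^ m) *ᵥ x) = ((1 + N') ^ m) *ᵥ f.gradAt x := by
    rw [← hPt, ← transpose_pow, mulVec_transpose, gradAt_eq_vecMul_pow hB x m, vecMul_vecMul,
      ← (show Commute (1 + N) P from hP.trans hP'.symm).mul_pow, hP, one_pow, vecMul_one]
  refine gradAt_ne_zero hns (x := fun i => (orbitPoly N D x i).coeff D) ?_ ?_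
  · intro h
    refine hx (funext fun i => ?_)
    have := congrFun h i
    simpa [coeff_orbitPoly, Nat.factorial_ne_zero] using this
  · ext i
    have hpoly : aeval (orbitPoly N D x) (pderiv i f) = orbitPoly N' D (f.gradAt x) i := by
      refine Polynomial.eq_of_infinite_eval_eq _ _
        ((Set.infinite_range_of_injective (Nat.cast_injective (R := k))).mono ?_)
      rintro _ ⟨m, rfl⟩
      rw [Set.mem_ofPred_eq, eval_orbitPoly hN', ← hgrad, ← Polynomial.coe_evalRingHom]
      have := eval₂_comp_left (Polynomial.evalRingHom (m : k)) Polynomial.C (orbitPoly N D x)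
        (pderiv i f)
      rw [aeval_def, Polynomial.algebraMap_eq, this]
      have hC : (Polynomial.evalRingHom (m : k)).comp Polynomial.C = RingHom.id k := by
        ext; simp
      have ho : Polynomial.evalRingHom (m : k) ∘ orbitPoly N D x = ((1 + N) ^ m) *ᵥ x :=
        funext fun j => eval_orbitPoly hND x j m
      rw [hC, ho]
      rfl
    rw [gradAt, ← (hf.pderiv (i := i)).coeff_aeval (natDegree_orbitPoly_le N D x), hpoly]
    exact Polynomial.coeff_eq_zero_of_natDegree_lt
      ((natDegree_orbitPoly_le _ _ _ _).trans_lt (by omega))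

variable [IsAlgClosed k]

theorem pow_eq_one_of_substM_eq (hf : f.IsHomogeneous 4) (hns : ¬ f.IsSingularForm)
    {B : Matrix (Fin 4) (Fin 4) k} (hB : substM B f = f) : B ^ 45360 = 1 := by
  refine eq_one_of_isNilpotent_sub_one hf hns (substM_pow hB _)
    ⟨Multiset.card B.charpoly.roots, ?_⟩
  have hdvd : B.charpoly ∣ (Polynomial.X ^ 45360 - 1) ^ Multiset.card B.charpoly.roots := by
    conv_lhs => rw [(IsAlgClosed.splits B.charpoly).eq_prod_roots_of_monic B.charpoly_monic]
    rw [← Multiset.prod_replicate, ← Multiset.map_const']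
    refine Multiset.prod_dvd_prod_of_dvd _ _ fun a ha => ?_
    rw [Polynomial.dvd_iff_isRoot]
    simp [pow_eq_one_of_mem_roots_charpoly hf hns hB ha]
  have h := Polynomial.aeval_eq_zero_of_dvd_aeval_eq_zero hdvd B.aeval_self_charpoly
  simpa only [map_pow, map_sub, Polynomial.aeval_X, map_one] using h

end Stabilizer

section ProjectiveAutomorphisms

variable {k : Type*} [Field k] {f : MvPolynomial (Fin 4) k}

/-- The matrices fixing `f`. -/
noncomputable def formStabilizer (f : MvPolynomial (Fin 4) k) : Subgroup (GL (Fin 4) k) where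
  carrier := {B | substM (B : Matrix (Fin 4) (Fin 4) k) f = f}
  one_mem' := substM_one f
  mul_mem' {A B} hA hB := by
    rw [Set.mem_ofPred_eq] at *
    rw [Units.val_mul, substM_mul, hA, hB]
  inv_mem' {A} hA := by
    rw [Set.mem_ofPred_eq] at *
    conv_lhs => rw [← hA]
    rw [← substM_mul, ← Units.val_mul, mul_inv_cancel, Units.val_one, substM_one]

theorem exists_mem_formStabilizer_iff [IsAlgClosed k] (hf : f.IsHomogeneous 4)
    (x : GL (Fin 4) k ⧸ Subgroup.center (GL (Fin 4) k)) :
    (∃ A : GL (Fin 4) k, QuotientGroup.mk A = x ∧ IsProjAut f A) ↔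
      x ∈ (formStabilizer f).map (QuotientGroup.mk' _) := by
  constructor
  · rintro ⟨A, rfl, c, hc⟩
    obtain ⟨μ, hμ⟩ := IsAlgClosed.exists_pow_nat_eq ((c⁻¹ : kˣ) : k) (n := 4) (by norm_num)
    have hμ0 : μ ≠ 0 := by
      rintro rfl
      exact (c⁻¹).ne_zero (by simpa using hμ.symm)
    let z : GL (Fin 4) k := Units.map (scalar (Fin 4)).toMonoidHom (Units.mk0 μ hμ0)
    have hz : z ∈ Subgroup.center (GL (Fin 4) k) :=
      GeneralLinearGroup.mem_center_iff_val_mem_range_scalar.mpr ⟨μ, rfl⟩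
    have hmem : A⁻¹ * z ∈ formStabilizer f := by
      have hval : ((A⁻¹ * z : GL (Fin 4) k) : Matrix (Fin 4) (Fin 4) k) =
          μ • ((A⁻¹ : GL (Fin 4) k) : Matrix (Fin 4) (Fin 4) k) := by
        rw [Units.val_mul]
        change _ * scalar (Fin 4) μ = _
        rw [scalar_apply, ← smul_one_eq_diagonal, mul_smul_comm, mul_one]
      change substM _ f = f
      rw [hval, substM_smul_matrix hf, hc, hμ, smul_smul, Units.inv_mul, one_smul]
    refine ⟨(A⁻¹ * z)⁻¹, (formStabilizer f).inv_mem hmem, ?_⟩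
    rw [QuotientGroup.mk'_apply, QuotientGroup.mk_inv, QuotientGroup.mk_mul_of_mem _ hz,
      QuotientGroup.mk_inv, inv_inv]
  · rintro ⟨A, hA, rfl⟩
    have hA' : substM ((A⁻¹ : GL (Fin 4) k) : Matrix (Fin 4) (Fin 4) k) f = f :=
      (formStabilizer f).inv_mem hA
    exact ⟨A, rfl, 1, by rw [hA', Units.val_one, one_smul]⟩

variable [IsAlgClosed k] [CharZero k]

theorem pow_eq_one_of_mem_formStabilizer (hf : f.IsHomogeneous 4) (hns : ¬ f.IsSingularForm)
    {B : GL (Fin 4) k} (hB : B ∈ formStabilizer f) : B ^ 45360 = 1 :=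
  Units.ext (by simpa using pow_eq_one_of_substM_eq hf hns hB)

theorem orderOf_ne_of_mem_map_formStabilizer (hf : f.IsHomogeneous 4) (hns : ¬ f.IsSingularForm)
    {p : ℕ} (hp : p.Prime) (hp11 : 11 ≤ p)
    {x : GL (Fin 4) k ⧸ Subgroup.center (GL (Fin 4) k)}
    (hx : x ∈ (formStabilizer f).map (QuotientGroup.mk' _)) : orderOf x ≠ p := by
  rintro rfl
  obtain ⟨B, hB, rfl⟩ := hx
  have hdvd := orderOf_dvd_of_pow_eq_one (x := QuotientGroup.mk' (Subgroup.center _) B)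
    (n := 45360) (by rw [← map_pow, pow_eq_one_of_mem_formStabilizer hf hns hB, map_one])
  rw [show 45360 = 9 ^ 2 * (8 * (7 * 10)) by norm_num, hp.dvd_mul, hp.dvd_mul, hp.dvd_mul] at hdvd
  rcases hdvd with h | h | h | h
  · exact absurd (Nat.le_of_dvd (by norm_num) (hp.dvd_of_dvd_pow h)) (by omega)
  all_goals exact absurd (Nat.le_of_dvd (by norm_num) h) (by omega)

end ProjectiveAutomorphisms

/-- for every prime `p ≥ 11`, every quartic form in `k[x,y,z,t]` invariant
under some subgroup of `PGL₄(k)` isomorphic to `ℤ/pℤ` is singular; equivalently, for a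
nonsingular quartic form `f`, `p` does not divide `|Paut(f)|`. -/
theorem stmt_14 {k : Type*} [Field k] [IsAlgClosed k] [CharZero k]
    (p : ℕ) (hp : p.Prime) (hp11 : 11 ≤ p) :
    (∀ f : MvPolynomial (Fin 4) k, f.IsHomogeneous 4 → f ≠ 0 →
      (∃ G : Subgroup (Matrix.GeneralLinearGroup (Fin 4) k ⧸
          Subgroup.center (Matrix.GeneralLinearGroup (Fin 4) k)),
        Nonempty (G ≃* Multiplicative (ZMod p)) ∧
        ∀ A : Matrix.GeneralLinearGroup (Fin 4) k,
          QuotientGroup.mk A ∈ G → IsProjAut f A) →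
      f.IsSingularForm) ∧
    (∀ f : MvPolynomial (Fin 4) k, f.IsHomogeneous 4 → f ≠ 0 → ¬ f.IsSingularForm →
      ¬ (p ∣ pautCard f)) := by
  refine ⟨fun f hf _ ⟨G, ⟨e⟩, hG⟩ => ?_, fun f hf _ hns hdvd => ?_⟩
  · by_contra hns
    let g : G := e.symm (Multiplicative.ofAdd 1)
    obtain ⟨A, hA⟩ := QuotientGroup.mk_surjective g.1
    have hg : (g : GL (Fin 4) k ⧸ Subgroup.center (GL (Fin 4) k)) ∈
        (formStabilizer f).map (QuotientGroup.mk' _) :=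
      (exists_mem_formStabilizer_iff hf _).mp ⟨A, hA, hG A (hA.symm ▸ g.2)⟩
    refine orderOf_ne_of_mem_map_formStabilizer hf hns hp hp11 hg ?_
    rw [Subgroup.orderOf_coe, MulEquiv.orderOf_eq, orderOf_ofAdd_eq_addOrderOf,
      ZMod.addOrderOf_one]
  · have := GeneralLinearGroup.finite_of_pow_eq_one (by norm_num) (formStabilizer f)
      fun g hg => pow_eq_one_of_mem_formStabilizer hf hns hg
    have : Finite ((formStabilizer f).map (QuotientGroup.mk' (Subgroup.center _))) :=
      Set.Finite.image _ (Set.toFinite (formStabilizer f : Set (GL (Fin 4) k)))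
    have hcard : pautCard f =
        Nat.card ((formStabilizer f).map (QuotientGroup.mk' (Subgroup.center _))) :=
      Nat.card_congr (Equiv.subtypeEquivRight (exists_mem_formStabilizer_iff hf))
    rw [hcard] at hdvd
    have := Fact.mk hp
    obtain ⟨x, hx⟩ := exists_prime_orderOf_dvd_card' p hdvd
    exact orderOf_ne_of_mem_map_formStabilizer hf hns hp hp11 x.2 ((Subgroup.orderOf_coe x).trans hx)
end
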